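/- For every ε > 0 there exists a positive integer n₀ such that every oriented graph G on n ≥ n₀ vertices containing no transitive triangle satisfies i(G) ≥ 1/9 − ε. -/

import Mathlib

open scoped Classical

/-- An oriented graph: a directed graph with no loops and no pair of
antiparallel edges, given by an asymmetric (hence irreflexive) adjacency
relation. -/
structure OrientedGraph (V : Type) [Fintype V] [DecidableEq V] where
  adj : V → V → Prop
  asymm : ∀ u v : V, adj u v → ¬ adj v u

namespace OrientedGraph

variable {V : Type} [Fintype V] [DecidableEq V]

/-- A 3-element vertex set spans a transitive triangle: its vertices are
pairwise adjacent and the induced orientation is acyclic. -/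
def isTransTriangle (G : OrientedGraph V) (s : Finset V) : Prop :=
  ∃ x y z : V, s = {x, y, z} ∧ G.adj x y ∧ G.adj y z ∧ G.adj x z

/-- A vertex set is independent: no two of its vertices are adjacent. -/
def isIndep (G : OrientedGraph V) (s : Finset V) : Prop :=
  ∀ x ∈ s, ∀ y ∈ s, ¬ G.adj x y

/-- `T₃(G)`: the number of 3-element vertex sets spanning a transitive triangle. -/
noncomputable def T3 (G : OrientedGraph V) : ℕ :=
  ((Finset.univ.powersetCard 3 : Finset (Finset V)).filter G.isTransTriangle).card

/-- `I₃(G)`: the number of 3-element vertex sets that are independent. -/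
noncomputable def I3 (G : OrientedGraph V) : ℕ :=
  ((Finset.univ.powersetCard 3 : Finset (Finset V)).filter G.isIndep).card

/-- `t(G) = T₃(G)/C(n,3)`. -/
noncomputable def tDens (G : OrientedGraph V) : ℝ :=
  (G.T3 : ℝ) / ((Fintype.card V).choose 3 : ℝ)

/-- `i(G) = I₃(G)/C(n,3)`. -/
noncomputable def iDens (G : OrientedGraph V) : ℝ :=
  (G.I3 : ℝ) / ((Fintype.card V).choose 3 : ℝ)

end OrientedGraph

/-! ### A sum-of-squares certificate on four vertices

The relation between two vertices is encoded by a sign: `1` for an arc out of the first vertex, `-1`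
for an arc into it and `0` for a nonadjacent pair. For a fixed pair `x, y`, a weight `φ` depending
on the signs from a third vertex `z` to `x` and to `y` gives the nonnegative quantity
`∑ z, ∑ w, φ z * φ w = (∑ z, φ z) ^ 2`. A suitable nonnegative combination of such squares bounds
the number of independent triples pointwise, after symmetrizing over the four vertices. -/

namespace OrientedGraph

/-- The indicator of nonadjacency. -/
def nonadjInd (t : SignType) : ℤ := if t = 0 then 1 else 0

/-- Weight on a nonadjacent pair comparing the three classes of a balanced blow-up of the directed
triangle. -/
def balanceWeight (a b : SignType) : ℤ := if a = b then (if a = 0 then 2 else -1) else 0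

/-- Signed weight of the vertices adjacent to exactly one vertex of a nonadjacent pair. -/
def singleWeight (a b : SignType) : ℤ := if a = 0 then (b : ℤ) else if b = 0 then (a : ℤ) else 0

/-- Signed weight of the vertices related in the same way to both vertices of a nonadjacent pair. -/
def twinWeight (a b : SignType) : ℤ := if a = b then (a : ℤ) else 0

/-- Weight comparing the degrees of two nonadjacent vertices. -/
def degreeWeight (a b : SignType) : ℤ := nonadjInd a - nonadjInd b

/-- Weight on an arc comparing the vertices adjacent to neither endpoint with those extending the arc
to an induced directed path. -/
def arcOuterWeight (a b : SignType) : ℤ :=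
  if a = 0 then (if b = 0 then 1 else if b = -1 then -1 else 0)
  else if a = 1 ∧ b = 0 then -1 else 0

/-- Weight on an arc comparing the other in-neighbours of the head with the other out-neighbours of
the tail. -/
def arcTwinWeight (a b : SignType) : ℤ :=
  if a = 0 ∧ b = 1 then 1 else if a = -1 ∧ b = 0 then -1 else 0

/-- Weight on an arc comparing its two kinds of extensions to an induced directed path. -/
def arcPathWeight (a b : SignType) : ℤ :=
  if a = 0 ∧ b = -1 then 1 else if a = 1 ∧ b = 0 then -1 else 0

/-- The quadratic form attached to a nonadjacent pair. -/
def nonadjForm (a b c d : SignType) : ℤ :=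
  4 * (balanceWeight a b * balanceWeight c d)
  + (4 * twinWeight a b + 3 * singleWeight a b) * (4 * twinWeight c d + 3 * singleWeight c d)
  + 5 * (singleWeight a b * singleWeight c d) + 9 * (degreeWeight a b * degreeWeight c d)

/-- The quadratic form attached to an arc. -/
def arcForm (a b c d : SignType) : ℤ :=
  7 * (arcOuterWeight a b * arcOuterWeight c d) + 13 * (arcTwinWeight a b * arcTwinWeight c d)
  + 13 * (arcPathWeight a b * arcPathWeight c d)

/-- The quadratic form attached to a pair with sign `t`, evaluated at two further vertices whose
signs to the pair are `a, b` and `c, d`. -/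
def pairForm (t a b c d : SignType) : ℤ :=
  if t = 0 then nonadjForm a b c d else if t = 1 then arcForm a b c d else arcForm b a d c

/-- The signs `a`, `b`, `c` of the pairs `xy`, `xz`, `yz` do not form a transitive triangle. -/
def TransFree (a b c : SignType) : Prop := a = 0 ∨ b = 0 ∨ c = 0 ∨ (a = c ∧ b = -a)

instance (a b c : SignType) : Decidable (TransFree a b c) := by unfold TransFree; infer_instance

/-- The indicator of an independent triple. -/
def indepInd (a b c : SignType) : ℤ := nonadjInd a * nonadjInd b * nonadjInd c

/-- The pointwise inequality behind the certificate; `a, …, f` are the signs of the pairs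
`xy, xz, xw, yz, yw, zw`. -/
theorem sum_pairForm_le_indepInd :
    ∀ a b d : SignType, TransFree a b d → ∀ c e : SignType, TransFree a c e →
      ∀ f : SignType, TransFree b c f → TransFree d e f →
      12 + (pairForm a (-b) (-d) (-c) (-e) + pairForm b (-a) d (-c) (-f)
          + pairForm c (-a) e (-b) f + pairForm d a b (-e) (-f)
          + pairForm e a c (-d) f + pairForm f b c d e)
        ≤ 27 * (indepInd a b d + indepInd a c e + indepInd b c f + indepInd d e f) := by
  decide +kernel

section Sums

variable {V : Type} [Fintype V]

theorem sum_sum_mul_self_nonneg (φ : V → ℤ) : 0 ≤ ∑ z, ∑ w, φ z * φ w := by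
  rw [← Finset.sum_mul_sum]
  exact mul_self_nonneg _

theorem sum_sum_nonadjForm_nonneg (u v : V → SignType) :
    0 ≤ ∑ z, ∑ w, nonadjForm (u z) (v z) (u w) (v w) := by
  have h₁ := sum_sum_mul_self_nonneg fun z => balanceWeight (u z) (v z)
  have h₂ := sum_sum_mul_self_nonneg fun z =>
    4 * twinWeight (u z) (v z) + 3 * singleWeight (u z) (v z)
  have h₃ := sum_sum_mul_self_nonneg fun z => singleWeight (u z) (v z)
  have h₄ := sum_sum_mul_self_nonneg fun z => degreeWeight (u z) (v z)
  have h := add_nonneg (add_nonneg (add_nonneg (mul_nonneg (by decide : (0 : ℤ) ≤ 4) h₁) h₂)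
    (mul_nonneg (by decide : (0 : ℤ) ≤ 5) h₃)) (mul_nonneg (by decide : (0 : ℤ) ≤ 9) h₄)
  simpa only [nonadjForm, Finset.sum_add_distrib, Finset.mul_sum] using h

theorem sum_sum_arcForm_nonneg (u v : V → SignType) :
    0 ≤ ∑ z, ∑ w, arcForm (u z) (v z) (u w) (v w) := by
  have h₁ := sum_sum_mul_self_nonneg fun z => arcOuterWeight (u z) (v z)
  have h₂ := sum_sum_mul_self_nonneg fun z => arcTwinWeight (u z) (v z)
  have h₃ := sum_sum_mul_self_nonneg fun z => arcPathWeight (u z) (v z)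
  have h := add_nonneg (add_nonneg (mul_nonneg (by decide : (0 : ℤ) ≤ 7) h₁)
    (mul_nonneg (by decide : (0 : ℤ) ≤ 13) h₂)) (mul_nonneg (by decide : (0 : ℤ) ≤ 13) h₃)
  simpa only [arcForm, Finset.sum_add_distrib, Finset.mul_sum] using h

theorem sum_sum_pairForm_nonneg (t : SignType) (u v : V → SignType) :
    0 ≤ ∑ z, ∑ w, pairForm t (u z) (v z) (u w) (v w) := by
  unfold pairForm
  split_ifs
  · exact sum_sum_nonadjForm_nonneg u v
  · exact sum_sum_arcForm_nonneg u v
  · exact sum_sum_arcForm_nonneg v u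

/-- Exchanging the two middle summations. -/
theorem sum_comm_middle (F : V → V → V → V → ℤ) :
    ∑ x, ∑ y, ∑ z, ∑ w, F x y z w = ∑ x, ∑ y, ∑ z, ∑ w, F x z y w :=
  Finset.sum_congr rfl fun _ _ => Finset.sum_comm

/-- Exchanging the two inner summations. -/
theorem sum_comm_inner (F : V → V → V → V → ℤ) :
    ∑ x, ∑ y, ∑ z, ∑ w, F x y z w = ∑ x, ∑ y, ∑ z, ∑ w, F x y w z :=
  Finset.sum_congr rfl fun _ _ => Finset.sum_congr rfl fun _ _ => Finset.sum_comm

/-- Exchanging the two outer summations. -/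
theorem sum_comm_outer (F : V → V → V → V → ℤ) :
    ∑ x, ∑ y, ∑ z, ∑ w, F x y z w = ∑ x, ∑ y, ∑ z, ∑ w, F y x z w :=
  Finset.sum_comm

/-- The number of ordered triples, with repetitions, that are independent. -/
theorem card_pow_three_le_sum_indepInd (s : V → V → SignType) (hs : ∀ x y, s y x = -s x y)
    (hT : ∀ x y z, TransFree (s x y) (s x z) (s y z)) :
    (Fintype.card V : ℤ) ^ 3 ≤ 9 * ∑ x, ∑ y, ∑ z, indepInd (s x y) (s x z) (s y z) := by
  set J : ℤ := ∑ x, ∑ y, ∑ z, indepInd (s x y) (s x z) (s y z) with hJ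
  set P : V → V → V → V → ℤ := fun x y z w =>
    pairForm (s x y) (s z x) (s z y) (s w x) (s w y) with hP
  have hpos : 0 ≤ ∑ x, ∑ y, ∑ z, ∑ w, P x y z w :=
    Finset.sum_nonneg fun x _ => Finset.sum_nonneg fun y _ =>
      sum_sum_pairForm_nonneg (s x y) (fun z => s z x) (fun z => s z y)
  have p₂ : ∑ x, ∑ y, ∑ z, ∑ w, P x z y w = ∑ x, ∑ y, ∑ z, ∑ w, P x y z w :=
    sum_comm_middle fun x y z w => P x z y w
  have p₃ : ∑ x, ∑ y, ∑ z, ∑ w, P x w y z = ∑ x, ∑ y, ∑ z, ∑ w, P x y z w :=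
    (sum_comm_inner fun x y z w => P x w y z).trans p₂
  have p₄ : ∑ x, ∑ y, ∑ z, ∑ w, P y z x w = ∑ x, ∑ y, ∑ z, ∑ w, P x y z w :=
    (sum_comm_outer fun x y z w => P y z x w).trans p₂
  have p₅ : ∑ x, ∑ y, ∑ z, ∑ w, P y w x z = ∑ x, ∑ y, ∑ z, ∑ w, P x y z w :=
    (sum_comm_inner fun x y z w => P y w x z).trans p₄
  have p₆ : ∑ x, ∑ y, ∑ z, ∑ w, P z w x y = ∑ x, ∑ y, ∑ z, ∑ w, P x y z w :=
    (sum_comm_middle fun x y z w => P z w x y).trans p₅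
  set K : V → V → V → ℤ := fun x y z => indepInd (s x y) (s x z) (s y z) with hK
  have hKJ : ∑ x, ∑ y, ∑ z, K x y z = J := rfl
  have hpoint : ∑ x, ∑ y, ∑ z, ∑ w, (12 + (P x y z w + P x z y w + P x w y z + P y z x w
        + P y w x z + P z w x y))
      ≤ ∑ x, ∑ y, ∑ z, ∑ w, 27 * (K x y z + K x y w + K x z w + K y z w) := by
    refine Finset.sum_le_sum fun x _ => Finset.sum_le_sum fun y _ => Finset.sum_le_sum fun z _ =>
      Finset.sum_le_sum fun w _ => ?_
    have h := sum_pairForm_le_indepInd _ _ _ (hT x y z) _ _ (hT x y w) _ (hT x z w) (hT y z w)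
    simpa only [hP, hK, ← hs] using h
  simp only [Finset.sum_add_distrib, ← Finset.mul_sum, p₂, p₃, p₄, p₅, p₆, hKJ,
    Finset.sum_const, Finset.card_univ, nsmul_eq_mul] at hpoint
  rcases isEmpty_or_nonempty V with hV | hV
  · simp [hJ]
  · have hn : (0 : ℤ) < Fintype.card V := by exact_mod_cast Fintype.card_pos
    refine le_of_mul_le_mul_left ?_ hn
    nlinarith

end Sums

/-- The sign of an ordered pair of vertices. -/
noncomputable def pairSign {V : Type} [Fintype V] [DecidableEq V] (G : OrientedGraph V)
    (x y : V) : SignType :=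
  if G.adj x y then 1 else if G.adj y x then -1 else 0

section Graph

variable {V : Type} [Fintype V] [DecidableEq V] (G : OrientedGraph V)

theorem pairSign_swap (x y : V) : G.pairSign y x = -G.pairSign x y := by
  have := G.asymm x y
  unfold pairSign
  split_ifs <;> simp_all

theorem pairSign_eq_zero_iff {x y : V} : G.pairSign x y = 0 ↔ ¬ G.adj x y ∧ ¬ G.adj y x := by
  unfold pairSign
  split_ifs <;> simp_all

theorem transFree_pairSign (hG : ∀ x y z : V, ¬ (G.adj x y ∧ G.adj y z ∧ G.adj x z))
    (x y z : V) : TransFree (G.pairSign x y) (G.pairSign x z) (G.pairSign y z) := by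
  have h₁ := hG x y z
  have h₂ := hG x z y
  have h₃ := hG y x z
  have h₄ := hG y z x
  have h₅ := hG z x y
  have h₆ := hG z y x
  unfold TransFree pairSign
  split_ifs <;> simp_all

/-- The ordered independent triples of distinct vertices. -/
noncomputable def indepTriples : Finset (V × V × V) :=
  Finset.univ.filter fun p => (p.1 ≠ p.2.1 ∧ p.1 ≠ p.2.2 ∧ p.2.1 ≠ p.2.2) ∧
    G.isIndep {p.1, p.2.1, p.2.2}

theorem card_indepTriples_le : G.indepTriples.card ≤ 6 * G.I3 := by
  refine Finset.card_le_mul_card_image_of_maps_to (f := fun p => {p.1, p.2.1, p.2.2}) ?_ 6 ?_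
  · rintro ⟨x, y, z⟩ hp
    simp only [indepTriples, Finset.mem_filter, Finset.mem_univ, true_and] at hp
    simp only [Finset.mem_filter, Finset.mem_powersetCard, Finset.subset_univ, true_and]
    exact ⟨Finset.card_eq_three.2 ⟨x, y, z, hp.1.1, hp.1.2.1, hp.1.2.2, rfl⟩, hp.2⟩
  · intro b hb
    simp only [Finset.mem_filter, Finset.mem_powersetCard, Finset.subset_univ, true_and] at hb
    obtain ⟨p, q, r, -, -, -, rfl⟩ := Finset.card_eq_three.1 hb.1
    refine (Finset.card_le_card (t := {(p, q, r), (p, r, q), (q, p, r), (q, r, p), (r, p, q),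
      (r, q, p)}) ?_).trans Finset.card_le_six
    rintro ⟨x, y, z⟩ h
    simp only [indepTriples, Finset.mem_filter, Finset.mem_univ, true_and] at h
    obtain ⟨⟨⟨hxy, hxz, hyz⟩, -⟩, hset⟩ := h
    have hx : x ∈ ({p, q, r} : Finset V) := hset ▸ by simp
    have hy : y ∈ ({p, q, r} : Finset V) := hset ▸ by simp
    have hz : z ∈ ({p, q, r} : Finset V) := hset ▸ by simp
    simp only [Finset.mem_insert, Finset.mem_singleton] at hx hy hz
    simp only [Finset.mem_insert, Finset.mem_singleton, Prod.mk.injEq]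
    rcases hx with rfl | rfl | rfl <;> rcases hy with rfl | rfl | rfl <;>
      rcases hz with rfl | rfl | rfl <;> simp_all

theorem indepInd_pairSign_le (x y z : V) :
    indepInd (G.pairSign x y) (G.pairSign x z) (G.pairSign y z)
      ≤ (if (x, y, z) ∈ G.indepTriples then 1 else 0)
        + ((if x = y then 1 else 0) + (if x = z then 1 else 0) + (if y = z then 1 else 0)) := by
  have irrefl : ∀ v, ¬ G.adj v v := fun v h => G.asymm v v h h
  by_cases h : G.pairSign x y = 0 ∧ G.pairSign x z = 0 ∧ G.pairSign y z = 0
  · obtain ⟨h₁, h₂, h₃⟩ := h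
    simp only [indepInd, nonadjInd, h₁, h₂, h₃]
    rw [pairSign_eq_zero_iff] at h₁ h₂ h₃
    have hI : G.isIndep {x, y, z} := by
      intro u hu v hv
      simp only [Finset.mem_insert, Finset.mem_singleton] at hu hv
      rcases hu with rfl | rfl | rfl <;> rcases hv with rfl | rfl | rfl <;> simp_all
    by_cases hxy : x = y
    · simp only [hxy, if_true]; split_ifs <;> norm_num
    by_cases hxz : x = z
    · simp only [hxz, if_true]; split_ifs <;> norm_num
    by_cases hyz : y = z
    · simp only [hyz, if_true]; split_ifs <;> norm_num
    simp [indepTriples, hxy, hxz, hyz, hI]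
  · have : indepInd (G.pairSign x y) (G.pairSign x z) (G.pairSign y z) = 0 := by
      simp only [indepInd, nonadjInd]
      split_ifs <;> simp_all
    rw [this]
    split_ifs <;> norm_num

theorem card_pow_three_le_I3 (hG : ∀ x y z : V, ¬ (G.adj x y ∧ G.adj y z ∧ G.adj x z)) :
    (Fintype.card V : ℤ) ^ 3 ≤ 54 * G.I3 + 27 * (Fintype.card V : ℤ) ^ 2 := by
  have h₁ := card_pow_three_le_sum_indepInd G.pairSign (fun x y => G.pairSign_swap x y)
    (G.transFree_pairSign hG)
  have h₂ : ∑ x, ∑ y, ∑ z, indepInd (G.pairSign x y) (G.pairSign x z) (G.pairSign y z)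
      ≤ G.indepTriples.card + 3 * (Fintype.card V : ℤ) ^ 2 := by
    refine (Finset.sum_le_sum fun x _ => Finset.sum_le_sum fun y _ => Finset.sum_le_sum fun z _ =>
      G.indepInd_pairSign_le x y z).trans ?_
    have hcard : ∑ x, ∑ y, ∑ z, (if (x, y, z) ∈ G.indepTriples then (1 : ℤ) else 0)
        = G.indepTriples.card := by
      simp_rw [← Fintype.sum_prod_type']
      simp
    simp only [Finset.sum_add_distrib, hcard]
    simp
    nlinarith
  have h₃ : (G.indepTriples.card : ℤ) ≤ 6 * G.I3 := by exact_mod_cast G.card_indepTriples_le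
  linarith

end Graph

end OrientedGraph

/-- For every ε > 0 there exists n₀ such that every oriented graph `G` on
`n ≥ n₀` vertices containing no transitive triangle satisfies
`i(G) ≥ 1/9 − ε`. -/
theorem stmt_11 (ε : ℝ) (hε : 0 < ε) :
    ∃ n₀ : ℕ, 0 < n₀ ∧ ∀ n : ℕ, n₀ ≤ n → ∀ G : OrientedGraph (Fin n),
      (∀ x y z : Fin n, ¬ (G.adj x y ∧ G.adj y z ∧ G.adj x z)) →
      1 / 9 - ε ≤ G.iDens := by
  refine ⟨⌈3 / ε⌉₊ + 3, by omega, fun n hn G hG => ?_⟩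
  have hn3 : 3 ≤ n := by omega
  have hnε : 3 ≤ ε * n := by
    have : 3 / ε ≤ n := (Nat.le_ceil _).trans (by exact_mod_cast (by omega : ⌈3 / ε⌉₊ ≤ n))
    rwa [div_le_iff₀' hε] at this
  have hI : (n : ℝ) ^ 3 ≤ 54 * G.I3 + 27 * (n : ℝ) ^ 2 := by
    have := G.card_pow_three_le_I3 hG
    rw [Fintype.card_fin] at this
    exact_mod_cast this
  have hC : ((n.choose 3 : ℕ) : ℝ) ≤ (n : ℝ) ^ 3 / 6 := by
    simpa [Nat.factorial] using Nat.choose_le_pow_div (α := ℝ) 3 n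
  have hpos : (0 : ℝ) < (n.choose 3 : ℕ) := by exact_mod_cast Nat.choose_pos hn3
  rw [OrientedGraph.iDens, Fintype.card_fin, le_div_iff₀ hpos]
  rcases le_total (1 / 9 - ε) 0 with h | h
  · exact (mul_nonpos_of_nonpos_of_nonneg h hpos.le).trans (Nat.cast_nonneg _)
  · have h₁ := mul_le_mul_of_nonneg_left hC h
    have h₂ := mul_le_mul_of_nonneg_right hnε (sq_nonneg (n : ℝ))
    nlinarith
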